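/- arXiv:1401.3143 — 3 statements merged into one kernel-verified Lean document; each statement's English description precedes it below -/
import Mathlib

section
/- For every x > 0, the kernel k(x) = 2 ∫₀^∞ e^{−xt} √t/(1 + t²) dt admits the closed-form evaluation k(x) = π√2 (sin x + cos x) − 2^{3/2} π [sin x · S(x) + cos x · C(x)]. -/
open MeasureTheory Set Filter
open scoped Real

/-- The Fresnel sine integral `S(x) = √(2/π) ∫₀^{√x} sin(t²) dt`. -/
noncomputable def fresnelS (x : ℝ) : ℝ :=
  Real.sqrt (2 / π) * ∫ t in (0 : ℝ)..Real.sqrt x, Real.sin (t ^ 2)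

/-- The Fresnel cosine integral `C(x) = √(2/π) ∫₀^{√x} cos(t²) dt`. -/
noncomputable def fresnelC (x : ℝ) : ℝ :=
  Real.sqrt (2 / π) * ∫ t in (0 : ℝ)..Real.sqrt x, Real.cos (t ^ 2)

noncomputable def kJ (φ : ℝ → ℝ) (x : ℝ) : ℝ := ∫ u in Ioi (0 : ℝ), Real.exp (-x * u ^ 2) * φ u

noncomputable def kphiA (u : ℝ) : ℝ := u ^ 2 / (1 + u ^ 4)

noncomputable def kphiB (u : ℝ) : ℝ := 1 / (1 + u ^ 4)

lemma k_cont {φ : ℝ → ℝ} (hφ : Continuous φ) (x : ℝ) :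
    Continuous (fun u : ℝ => Real.exp (-x * u ^ 2) * φ u) := by fun_prop

lemma kphiA_cont : Continuous kphiA := by
  unfold kphiA
  exact Continuous.div (by fun_prop) (by fun_prop) (fun u => by positivity)

lemma kphiB_cont : Continuous kphiB := by
  unfold kphiB
  exact Continuous.div (by fun_prop) (by fun_prop) (fun u => by positivity)

lemma kphiA_int : Integrable kphiA := by
  refine (integrable_inv_one_add_sq.const_mul 2).mono' kphiA_cont.aestronglyMeasurable ?_
  refine Eventually.of_forall fun u => ?_
  unfold kphiA
  rw [Real.norm_of_nonneg (by positivity), ← div_eq_mul_inv, div_le_div_iff₀ (by positivity) (by positivity)]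
  nlinarith [sq_nonneg (u ^ 2 - 1), sq_nonneg u]

lemma kphiB_int : Integrable kphiB := by
  refine (integrable_inv_one_add_sq.const_mul 2).mono' kphiB_cont.aestronglyMeasurable ?_
  refine Eventually.of_forall fun u => ?_
  unfold kphiB
  rw [Real.norm_of_nonneg (by positivity), ← div_eq_mul_inv, div_le_div_iff₀ (by positivity) (by positivity)]
  nlinarith [sq_nonneg (u ^ 2 - 1), sq_nonneg u]

lemma kJ_integrand {φ : ℝ → ℝ} (hφ : Continuous φ) (hi : Integrable φ) {x : ℝ} (hx : 0 ≤ x) :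
    Integrable (fun u : ℝ => Real.exp (-x * u ^ 2) * φ u) := by
  refine hi.norm.mono' (k_cont hφ x).aestronglyMeasurable (Eventually.of_forall fun u => ?_)
  rw [norm_mul, Real.norm_of_nonneg (Real.exp_pos _).le]
  have : Real.exp (-x * u ^ 2) ≤ 1 := by
    rw [Real.exp_le_one_iff]; nlinarith [mul_nonneg hx (sq_nonneg u)]
  exact mul_le_of_le_one_left (norm_nonneg _) this

lemma kJ_cont {φ : ℝ → ℝ} (hφ : Continuous φ) (hi : Integrable φ) :
    ContinuousOn (kJ φ) (Ici 0) := by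
  unfold kJ
  refine continuousOn_of_dominated (bound := fun u => ‖φ u‖) ?_ ?_ hi.norm.integrableOn ?_
  · intro x _
    exact (k_cont hφ x).aestronglyMeasurable
  · intro x hx
    refine Eventually.of_forall fun u => ?_
    rw [norm_mul, Real.norm_of_nonneg (Real.exp_pos _).le]
    have : Real.exp (-x * u ^ 2) ≤ 1 := by
      rw [Real.exp_le_one_iff]; nlinarith [mul_nonneg (mem_Ici.1 hx) (sq_nonneg u)]
    exact mul_le_of_le_one_left (norm_nonneg _) this
  · exact Eventually.of_forall fun u => by fun_prop

lemma kJ_deriv {φ : ℝ → ℝ} (hφ : Continuous φ) (hi : Integrable φ)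
    (hb : ∀ u, |u ^ 2 * φ u| ≤ 1) {x : ℝ} (hx : 0 < x) :
    HasDerivAt (kJ φ) (∫ u in Ioi (0 : ℝ), Real.exp (-x * u ^ 2) * (-(u ^ 2 * φ u))) x := by
  unfold kJ
  refine (hasDerivAt_integral_of_dominated_loc_of_deriv_le (s := Ioi (x / 2))
    (F' := fun x u => Real.exp (-x * u ^ 2) * (-(u ^ 2 * φ u)))
    (bound := fun u => Real.exp (-(x / 2) * u ^ 2)) (Ioi_mem_nhds (by linarith)) ?_ ?_ ?_ ?_ ?_ ?_).2
  · exact Eventually.of_forall fun y => (k_cont hφ y).aestronglyMeasurable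
  · exact (kJ_integrand hφ hi hx.le).integrableOn
  · exact (k_cont (φ := fun u => -(u ^ 2 * φ u)) (by fun_prop) x).aestronglyMeasurable
  · refine Eventually.of_forall fun u y hy => ?_
    rw [norm_mul, Real.norm_of_nonneg (Real.exp_pos _).le, norm_neg, Real.norm_eq_abs]
    have h1 : Real.exp (-y * u ^ 2) ≤ Real.exp (-(x / 2) * u ^ 2) := by
      apply Real.exp_le_exp.2
      nlinarith [mul_nonneg (sub_nonneg.2 (mem_Ioi.1 hy).le) (sq_nonneg u)]
    calc _ ≤ Real.exp (-y * u ^ 2) * 1 := by gcongr; exact hb u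
      _ ≤ _ := by linarith
  · exact (integrable_exp_neg_mul_sq (by linarith)).integrableOn
  · refine Eventually.of_forall fun u y hy => ?_
    have h := (((hasDerivAt_id y).neg.mul_const (u ^ 2)).exp).mul_const (φ u)
    refine h.congr_deriv ?_
    simp
    ring

lemma kB_deriv {x : ℝ} (hx : 0 < x) : HasDerivAt (kJ kphiB) (-kJ kphiA x) x := by
  refine (kJ_deriv kphiB_cont kphiB_int ?_ hx).congr_deriv ?_
  · intro u
    unfold kphiB
    rw [abs_of_nonneg (by positivity), mul_one_div, div_le_one (by positivity)]
    nlinarith [sq_nonneg (u ^ 2 - 1), sq_nonneg u]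
  · unfold kJ
    rw [← integral_neg]
    congr 1; ext u
    unfold kphiA kphiB
    ring

lemma kA_deriv {x : ℝ} (hx : 0 < x) :
    HasDerivAt (kJ kphiA) (kJ kphiB x - √(π / x) / 2) x := by
  refine (kJ_deriv kphiA_cont kphiA_int ?_ hx).congr_deriv ?_
  · intro u
    unfold kphiA
    rw [abs_of_nonneg (by positivity), ← mul_div_assoc, div_le_one (by positivity)]
    nlinarith [sq_nonneg (u ^ 2 - 1), sq_nonneg u]
  · unfold kJ
    rw [← integral_gaussian_Ioi, ← integral_sub
      (kJ_integrand kphiB_cont kphiB_int hx.le).integrableOn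
      (integrable_exp_neg_mul_sq hx).integrableOn]
    congr 1; ext u
    unfold kphiA kphiB
    have : (1 + u ^ 4) ≠ 0 := by positivity
    field_simp
    ring

lemma k_eq : ∫ u in Ioi (0 : ℝ), kphiB u = ∫ u in Ioi (0 : ℝ), kphiA u := by
  rw [← integral_comp_rpow_Ioi kphiA (p := -1) (by norm_num)]
  refine setIntegral_congr_fun measurableSet_Ioi fun u hu => ?_
  have hu : 0 < u := hu
  have h2 : u ^ ((-1 : ℝ) - 1) = (u ^ 2)⁻¹ := by
    rw [show (-1 : ℝ) - 1 = -((2 : ℕ) : ℝ) by norm_num, Real.rpow_neg hu.le, Real.rpow_natCast]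
  simp only [h2, Real.rpow_neg_one, kphiA, kphiB, smul_eq_mul, abs_neg, abs_one, one_mul]
  field_simp
  ring

lemma k_sum : (∫ u in Ioi (0 : ℝ), (kphiA u + kphiB u)) = π / √2 := by
  have h2 : √2 ^ 2 = 2 := Real.sq_sqrt (by norm_num)
  have h0 : 0 < √2 := by positivity
  have key := integral_Ioi_of_hasDerivAt_of_tendsto (a := 0) (m := (π / 2 + π / 2) / √2)
    (f := fun u : ℝ => (Real.arctan (√2 * u + 1) + Real.arctan (√2 * u - 1)) / √2)
    (f' := fun u => kphiA u + kphiB u) ?_ ?_ ?_ ?_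
  · rw [key]
    simp [Real.arctan_neg]
  · exact Continuous.continuousWithinAt (by fun_prop)
  · intro u _
    have e1 : HasDerivAt (fun u : ℝ => √2 * u + 1) (√2 * 1) u :=
      ((hasDerivAt_id u).const_mul _).add_const _
    have e2 : HasDerivAt (fun u : ℝ => √2 * u - 1) (√2 * 1) u :=
      ((hasDerivAt_id u).const_mul _).sub_const _
    refine ((e1.arctan.add e2.arctan).div_const _).congr_deriv ?_
    unfold kphiA kphiB
    have p1 : (1 + (√2 * u + 1) ^ 2) ≠ 0 := by positivity
    have p2 : (1 + (√2 * u - 1) ^ 2) ≠ 0 := by positivity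
    have p3 : (1 + u ^ 4) ≠ 0 := by positivity
    have q : (1 + (√2 * u + 1) ^ 2) * (1 + (√2 * u - 1) ^ 2) = 4 * (1 + u ^ 4) := by
      linear_combination (u ^ 4 * (√2 ^ 2 + 2)) * h2
    have q' : (1 + (√2 * u + 1) ^ 2) + (1 + (√2 * u - 1) ^ 2) = 4 * (1 + u ^ 2) := by
      linear_combination (2 * u ^ 2) * h2
    calc _ = ((1 + (√2 * u + 1) ^ 2) + (1 + (√2 * u - 1) ^ 2)) /
          ((1 + (√2 * u + 1) ^ 2) * (1 + (√2 * u - 1) ^ 2)) := by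
            field_simp
            ring
      _ = _ := by
        rw [q, q']
        field_simp
        ring
  · exact (kphiA_int.add kphiB_int).integrableOn
  · have ha := Real.tendsto_arctan_atTop.mono_right nhdsWithin_le_nhds
    have t : Tendsto (fun u : ℝ => √2 * u) atTop atTop := tendsto_id.const_mul_atTop h0
    exact ((ha.comp (tendsto_atTop_add_const_right _ 1 t)).add
      (ha.comp (tendsto_atTop_add_const_right _ (-1) t))).div_const _

lemma k_zero : kJ kphiA 0 = π / √2 / 2 ∧ kJ kphiB 0 = π / √2 / 2 := by
  have h := k_sum
  rw [integral_add kphiA_int.integrableOn kphiB_int.integrableOn] at h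
  have h' := k_eq
  simp only [kJ, neg_zero, zero_mul, Real.exp_zero, one_mul]
  constructor <;> linarith

lemma k_subst (x : ℝ) :
    ∫ t in Ioi (0 : ℝ), Real.exp (-(x * t)) * Real.sqrt t / (1 + t ^ 2) = 2 * kJ kphiA x := by
  rw [← integral_comp_rpow_Ioi_of_pos (p := 2) (by norm_num), kJ, ← integral_const_mul]
  refine setIntegral_congr_fun measurableSet_Ioi fun u hu => ?_
  have hu : 0 < u := hu
  have h1 : u ^ ((2 : ℝ) - 1) = u := by norm_num
  simp only [h1, Real.rpow_two, smul_eq_mul, Real.sqrt_sq hu.le, kphiA, neg_mul]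
  ring

lemma k_sqrt {s : ℝ} (hs : 0 < s) : 2 * s * (√(π / s ^ 2) / 2) = √π := by
  rw [Real.sqrt_div Real.pi_pos.le, Real.sqrt_sq hs.le]
  field_simp

lemma k_aA {s : ℝ} (hs : 0 < s) :
    HasDerivAt (fun s => kJ kphiA (s ^ 2)) (2 * s * kJ kphiB (s ^ 2) - √π) s := by
  have h := HasDerivAt.comp (h₂ := kJ kphiA) (h := fun s : ℝ => s ^ 2) s
    (kA_deriv (pow_pos hs 2)) (hasDerivAt_pow 2 s)
  refine h.congr_deriv ?_
  rw [← k_sqrt hs]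
  push_cast
  ring

lemma k_aB {s : ℝ} (hs : 0 < s) :
    HasDerivAt (fun s => kJ kphiB (s ^ 2)) (-(2 * s * kJ kphiA (s ^ 2))) s := by
  have h := HasDerivAt.comp (h₂ := kJ kphiB) (h := fun s : ℝ => s ^ 2) s
    (kB_deriv (pow_pos hs 2)) (hasDerivAt_pow 2 s)
  refine h.congr_deriv ?_
  push_cast
  ring

lemma k_contS {φ : ℝ → ℝ} (hφ : Continuous φ) (hi : Integrable φ) :
    Continuous (fun s : ℝ => kJ φ (s ^ 2)) :=
  (kJ_cont hφ hi).comp_continuous (by fun_prop) (fun s => sq_nonneg s)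

lemma k_P {r : ℝ} (hr : 0 ≤ r) :
    -√π * (∫ s in (0 : ℝ)..r, Real.cos (s ^ 2)) =
      Real.cos (r ^ 2) * kJ kphiA (r ^ 2) - Real.sin (r ^ 2) * kJ kphiB (r ^ 2) - π / √2 / 2 := by
  have cA := k_contS kphiA_cont kphiA_int
  have cB := k_contS kphiB_cont kphiB_int
  rw [← intervalIntegral.integral_const_mul]
  rw [intervalIntegral.integral_eq_sub_of_hasDerivAt_of_le (f := fun s : ℝ =>
    Real.cos (s ^ 2) * kJ kphiA (s ^ 2) - Real.sin (s ^ 2) * kJ kphiB (s ^ 2)) hr]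
  · simp [k_zero.1]
  · exact Continuous.continuousOn (by fun_prop)
  · intro s hs
    have hp := hasDerivAt_pow 2 s
    refine ((hp.cos.mul (k_aA hs.1)).sub (hp.sin.mul (k_aB hs.1))).congr_deriv ?_
    push_cast
    ring
  · exact Continuous.intervalIntegrable (by fun_prop) _ _

lemma k_Q {r : ℝ} (hr : 0 ≤ r) :
    -√π * (∫ s in (0 : ℝ)..r, Real.sin (s ^ 2)) =
      Real.sin (r ^ 2) * kJ kphiA (r ^ 2) + Real.cos (r ^ 2) * kJ kphiB (r ^ 2) - π / √2 / 2 := by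
  have cA := k_contS kphiA_cont kphiA_int
  have cB := k_contS kphiB_cont kphiB_int
  rw [← intervalIntegral.integral_const_mul]
  rw [intervalIntegral.integral_eq_sub_of_hasDerivAt_of_le (f := fun s : ℝ =>
    Real.sin (s ^ 2) * kJ kphiA (s ^ 2) + Real.cos (s ^ 2) * kJ kphiB (s ^ 2)) hr]
  · simp [k_zero.2]
  · exact Continuous.continuousOn (by fun_prop)
  · intro s hs
    have hp := hasDerivAt_pow 2 s
    refine ((hp.sin.mul (k_aA hs.1)).add (hp.cos.mul (k_aB hs.1))).congr_deriv ?_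
    push_cast
    ring
  · exact Continuous.intervalIntegrable (by fun_prop) _ _

lemma k_const : (2 : ℝ) ^ ((3 : ℝ) / 2) * π * √(2 / π) = 4 * √π := by
  have h2 : √2 ^ 2 = 2 := Real.sq_sqrt (by norm_num)
  have hp : √π ^ 2 = π := Real.sq_sqrt Real.pi_pos.le
  have h3 : (2 : ℝ) ^ ((3 : ℝ) / 2) = 2 * √2 := by
    rw [show (3 : ℝ) / 2 = 1 + 1 / 2 by norm_num, Real.rpow_add (by norm_num), Real.rpow_one,
      Real.sqrt_eq_rpow]
  have h0 : 0 < √π := Real.sqrt_pos.2 Real.pi_pos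
  rw [h3, Real.sqrt_div (by norm_num), ← mul_div_assoc, div_eq_iff h0.ne']
  linear_combination 2 * π * h2 - 4 * hp

/-- Closed-form evaluation of the kernel `k(x) = 2 ∫₀^∞ e^{-xt} √t/(1+t²) dt` in terms of
Fresnel integrals. -/
theorem kernel_closed_form (x : ℝ) (hx : 0 < x) :
    2 * ∫ t in Ioi (0 : ℝ), Real.exp (-(x * t)) * Real.sqrt t / (1 + t ^ 2) =
      π * Real.sqrt 2 * (Real.sin x + Real.cos x) -
        (2 : ℝ) ^ ((3 : ℝ) / 2) * π *
          (Real.sin x * fresnelS x + Real.cos x * fresnelC x) := by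
  have hP := k_P (Real.sqrt_nonneg x)
  have hQ := k_Q (Real.sqrt_nonneg x)
  rw [Real.sq_sqrt hx.le] at hP hQ
  rw [k_subst]
  unfold fresnelS fresnelC
  have hd : π / √2 = π * √2 / 2 := by
    have h2 : √2 ^ 2 = 2 := Real.sq_sqrt (by norm_num)
    rw [div_eq_iff (by positivity)]
    linear_combination -π / 2 * h2
  rw [hd] at hP hQ
  have hc := k_const
  have hsc := Real.sin_sq_add_cos_sq x
  set I := ∫ t in (0 : ℝ)..Real.sqrt x, Real.sin (t ^ 2)
  set K := ∫ t in (0 : ℝ)..Real.sqrt x, Real.cos (t ^ 2)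
  linear_combination (Real.sin x * I + Real.cos x * K) * hc - 4 * Real.cos x * hP -
    4 * Real.sin x * hQ - 4 * kJ kphiA x * hsc
end

section
/- For every x ≥ 0, the identity √(2/π) [sin x · S(x) + cos x · C(x)] = (1/π) ∫₀^x cos t/√(x − t) dt holds. -/
open MeasureTheory Set Filter
open scoped Real

/-- Abel-type integral representation of the Fresnel combination:
`√(2/π) [sin x · S(x) + cos x · C(x)] = (1/π) ∫₀^x cos t/√(x-t) dt` for `x ≥ 0`. -/
theorem fresnel_combination_eq_integral (x : ℝ) (hx : 0 ≤ x) :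
    Real.sqrt (2 / π) * (Real.sin x * fresnelS x + Real.cos x * fresnelC x) =
      (1 / π) * ∫ t in (0 : ℝ)..x, Real.cos t / Real.sqrt (x - t) := by
  have himg : (fun s : ℝ => x - s ^ 2) '' Ioo 0 (Real.sqrt x) = Ioo 0 x := by
    ext t
    constructor
    · rintro ⟨s, ⟨h0, h1⟩, rfl⟩
      have h2 : s ^ 2 < x := (Real.lt_sqrt h0.le).1 h1
      exact ⟨by simpa using h2, by simpa using pow_pos h0 2⟩
    · rintro ⟨h0, h1⟩
      refine ⟨Real.sqrt (x - t), ⟨Real.sqrt_pos.2 (by linarith),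
        Real.sqrt_lt_sqrt (by linarith) (by linarith)⟩, ?_⟩
      simp only
      rw [Real.sq_sqrt (by linarith)]
      ring
  have key : ∫ t in (0 : ℝ)..x, Real.cos t / Real.sqrt (x - t) =
      ∫ s in (0 : ℝ)..Real.sqrt x, 2 * Real.cos (x - s ^ 2) := by
    rw [intervalIntegral.integral_of_le hx, intervalIntegral.integral_of_le (Real.sqrt_nonneg x),
      integral_Ioc_eq_integral_Ioo, integral_Ioc_eq_integral_Ioo, ← himg,
      integral_image_eq_integral_abs_deriv_smul (f' := fun s => -(2 * s)) measurableSet_Ioo]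
    · refine setIntegral_congr_fun measurableSet_Ioo ?_
      intro s hs
      have h0 : 0 < s := hs.1
      simp only [smul_eq_mul, abs_neg, sub_sub_cancel]
      rw [Real.sqrt_sq h0.le, abs_of_pos (by linarith)]
      field_simp
    · intro s _
      have h := ((hasDerivAt_id s).pow 2).const_sub x
      simp at h
      exact h.hasDerivWithinAt
    · intro a ha b hb hab
      have h : a ^ 2 = b ^ 2 := by simpa using hab
      exact (pow_left_inj₀ ha.1.le hb.1.le two_ne_zero).1 h
  have hs : IntervalIntegrable (fun t : ℝ => Real.sin x * Real.sin (t ^ 2)) volume 0 (Real.sqrt x) :=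
    (by fun_prop : Continuous _).intervalIntegrable _ _
  have hc : IntervalIntegrable (fun t : ℝ => Real.cos x * Real.cos (t ^ 2)) volume 0 (Real.sqrt x) :=
    (by fun_prop : Continuous _).intervalIntegrable _ _
  have hsplit : ∫ s in (0 : ℝ)..Real.sqrt x, Real.cos (x - s ^ 2) =
      Real.cos x * (∫ t in (0 : ℝ)..Real.sqrt x, Real.cos (t ^ 2)) +
      Real.sin x * ∫ t in (0 : ℝ)..Real.sqrt x, Real.sin (t ^ 2) := by
    simp_rw [Real.cos_sub]
    rw [intervalIntegral.integral_add hc hs, intervalIntegral.integral_const_mul,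
      intervalIntegral.integral_const_mul]
  have hq : Real.sqrt (2 / π) * Real.sqrt (2 / π) = 2 / π :=
    Real.mul_self_sqrt (by positivity)
  rw [key, intervalIntegral.integral_const_mul, hsplit, fresnelS, fresnelC]
  linear_combination (Real.sin x * (∫ t in (0 : ℝ)..Real.sqrt x, Real.sin (t ^ 2)) +
    Real.cos x * ∫ t in (0 : ℝ)..Real.sqrt x, Real.cos (t ^ 2)) * hq
end

section
/- Analyticity of the Mellin–Barnes representation: let F : ℝ → ℂ be measurable with ∫_{-∞}^{∞} e^{π|τ|} |F(τ)| dτ < ∞. Then the function Φ(z) = (2π)^{-1} ∫_{-∞}^{∞} Γ(1/2 + iτ) [sin(π(1/2 + iτ)/2) + cos(π(1/2 + iτ)/2)] F(τ) z^{−(1/2 + iτ)} dτ is well defined (the integral converges absolutely) and holomorphic on the slit plane {z ∈ ℂ : z ∉ (−∞, 0]}, where z^{−s} = exp(−s log z) with the principal branch of the logarithm. -/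
open MeasureTheory Set Filter
open scoped Real

noncomputable def mbK (τ : ℝ) : ℂ := Complex.Gamma (1 / 2 + τ * Complex.I) *
          (Complex.sin (π * (1 / 2 + τ * Complex.I) / 2) +
            Complex.cos (π * (1 / 2 + τ * Complex.I) / 2))

lemma mb_sin (τ : ℝ) : Complex.sin (π * (1 / 2 + τ * Complex.I)) = ((Real.cosh (π * τ) : ℝ) : ℂ) := by
  have : (π : ℂ) * (1 / 2 + τ * Complex.I) = ((π * τ : ℝ) : ℂ) * Complex.I + π / 2 := by
    push_cast; ring
  rw [this, Complex.sin_add_pi_div_two, Complex.cos_mul_I, Complex.ofReal_cosh]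

lemma mbK_bound (τ : ℝ) : ‖mbK τ‖ ≤ √(2 * π) := by
  have hc : 1 ≤ Real.cosh (π * τ) := Real.one_le_cosh _
  have h1 : ‖Complex.Gamma (1 / 2 + τ * Complex.I)‖ ^ 2 = π / Real.cosh (π * τ) := by
    have h := Complex.Gamma_mul_Gamma_one_sub (1 / 2 + τ * Complex.I)
    have h2 : (1 - (1 / 2 + τ * Complex.I) : ℂ) = (starRingEnd ℂ) (1 / 2 + τ * Complex.I) := by
      apply Complex.ext <;> simp
      norm_num
    rw [h2, Complex.Gamma_conj, mb_sin, Complex.mul_conj, Complex.normSq_eq_norm_sq] at h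
    exact_mod_cast h
  have h3 : ‖Complex.sin (π * (1 / 2 + τ * Complex.I) / 2) +
            Complex.cos (π * (1 / 2 + τ * Complex.I) / 2)‖ ^ 2 = 1 + Real.cosh (π * τ) := by
    rw [← norm_pow]
    have : (Complex.sin (π * (1 / 2 + τ * Complex.I) / 2) +
            Complex.cos (π * (1 / 2 + τ * Complex.I) / 2)) ^ 2 = ((1 + Real.cosh (π * τ) : ℝ) : ℂ) := by
      rw [Complex.ofReal_add, ← mb_sin]
      set w : ℂ := π * (1 / 2 + τ * Complex.I) / 2 with hw
      rw [show (π : ℂ) * (1 / 2 + τ * Complex.I) = 2 * w by rw [hw]; ring, Complex.sin_two_mul,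
        Complex.ofReal_one]
      linear_combination Complex.sin_sq_add_cos_sq w
    rw [this, Complex.norm_real, Real.norm_eq_abs, abs_of_nonneg (by linarith)]
  apply Real.le_sqrt_of_sq_le
  rw [mbK, norm_mul, mul_pow, h1, h3, div_mul_eq_mul_div, div_le_iff₀ (by linarith)]
  nlinarith [Real.pi_pos]

lemma mbK_cont : Continuous mbK := by
  unfold mbK
  refine Continuous.mul ?_ (by fun_prop)
  rw [continuous_iff_continuousAt]
  intro τ
  have h : ContinuousAt Complex.Gamma (1 / 2 + τ * Complex.I) := by
    apply (Complex.differentiableAt_Gamma _ _).continuousAt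
    intro m h
    have := congrArg Complex.re h
    simp at this
    have hm : (0 : ℝ) ≤ m := Nat.cast_nonneg m
    linarith
  exact ContinuousAt.comp (f := fun τ : ℝ => (1 / 2 + τ * Complex.I : ℂ)) h (by fun_prop)

lemma mb_cpow_norm (z : ℂ) (hz : z ≠ 0) (a τ : ℝ) :
    ‖z ^ (-((a : ℂ) + τ * Complex.I))‖ ≤ ‖z‖ ^ (-a) * Real.exp (|z.arg| * |τ|) := by
  rw [Complex.norm_cpow_of_ne_zero hz, div_eq_mul_inv, ← Real.exp_neg]
  have h1 : (-((a : ℂ) + τ * Complex.I)).re = -a := by simp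
  have h2 : (-((a : ℂ) + τ * Complex.I)).im = -τ := by simp
  rw [h1, h2]
  gcongr
  rw [← abs_mul]
  have := le_abs_self (z.arg * τ)
  linarith

lemma mb_meas (F : ℝ → ℂ) (hF : Measurable F) (z : ℂ) (hz : z ∈ Complex.slitPlane) :
    AEStronglyMeasurable (fun τ : ℝ => mbK τ * F τ * z ^ (-(1 / 2 + τ * Complex.I))) volume := by
  have hz0 := Complex.slitPlane_ne_zero hz
  refine (mbK_cont.aestronglyMeasurable.mul hF.aestronglyMeasurable).mul ?_
  apply Continuous.aestronglyMeasurable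
  exact Continuous.const_cpow (by fun_prop) (Or.inl hz0)

lemma mb_int (F : ℝ → ℂ) (hF : Measurable F)
    (hint : Integrable (fun τ : ℝ => Real.exp (π * |τ|) * ‖F τ‖)) (z : ℂ)
    (hz : z ∈ Complex.slitPlane) :
    Integrable (fun τ : ℝ => mbK τ * F τ * z ^ (-(1 / 2 + τ * Complex.I))) := by
  have hz0 := Complex.slitPlane_ne_zero hz
  refine (hint.const_mul (√(2 * π) * ‖z‖ ^ (-(1 / 2 : ℝ)))).mono' (mb_meas F hF z hz) ?_
  refine Eventually.of_forall fun τ => ?_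
  have h := mb_cpow_norm z hz0 (1 / 2) τ
  push_cast at h
  rw [norm_mul, norm_mul]
  calc _ ≤ √(2 * π) * ‖F τ‖ * (‖z‖ ^ (-(1 / 2 : ℝ)) * Real.exp (|z.arg| * |τ|)) := by
        gcongr
        exact mbK_bound τ
    _ ≤ √(2 * π) * ‖F τ‖ * (‖z‖ ^ (-(1 / 2 : ℝ)) * Real.exp (π * |τ|)) := by
        gcongr
        exact Complex.abs_arg_le_pi z
    _ = _ := by ring

lemma mb_diff (F : ℝ → ℂ) (hF : Measurable F)
    (hint : Integrable (fun τ : ℝ => Real.exp (π * |τ|) * ‖F τ‖)) (z₀ : ℂ)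
    (hz : z₀ ∈ Complex.slitPlane) :
    DifferentiableAt ℂ (fun z : ℂ => ∫ τ : ℝ, mbK τ * F τ * z ^ (-(1 / 2 + τ * Complex.I))) z₀ := by
  have hz0 := Complex.slitPlane_ne_zero hz
  have hn : 0 < ‖z₀‖ := norm_pos_iff.2 hz0
  have harg : |z₀.arg| < π :=
    lt_of_le_of_ne (Complex.abs_arg_le_pi _) (by
      intro h
      rcases (Complex.mem_slitPlane_iff_arg.1 hz) with ⟨h1, _⟩
      rcases abs_eq Real.pi_pos.le |>.1 h with h | h
      · exact h1 h
      · have := Complex.neg_pi_lt_arg z₀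
        linarith)
  obtain ⟨δ, hδ, hδ2⟩ : ∃ δ > 0, |z₀.arg| < π - δ := ⟨(π - |z₀.arg|) / 2, by linarith, by linarith⟩
  let s : Set ℂ := {z | z ∈ Complex.slitPlane ∧ |z.arg| < π - δ ∧ ‖z₀‖ / 2 < ‖z‖}
  have hs : s ∈ nhds z₀ := by
    have e1 : ∀ᶠ z in nhds z₀, z ∈ Complex.slitPlane := Complex.isOpen_slitPlane.mem_nhds hz
    have e2 : ∀ᶠ z in nhds z₀, |z.arg| < π - δ :=
      (Complex.continuousAt_arg hz).abs.eventually_lt continuousAt_const hδ2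
    have e3 : ∀ᶠ z in nhds z₀, ‖z₀‖ / 2 < ‖z‖ :=
      continuousAt_const.eventually_lt continuous_norm.continuousAt (by linarith)
    exact e1.and (e2.and e3)
  let F' : ℂ → ℝ → ℂ := fun z τ => mbK τ * F τ *
    (-(1 / 2 + τ * Complex.I) * z ^ (-(1 / 2 + τ * Complex.I) - 1))
  let C : ℝ := √(2 * π) * (1 / 2 + 1 / δ) * (‖z₀‖ / 2) ^ (-(3 / 2 : ℝ))
  refine (hasDerivAt_integral_of_dominated_loc_of_deriv_le (F' := F')
    (bound := fun τ => C * (Real.exp (π * |τ|) * ‖F τ‖)) hs ?_ (mb_int F hF hint z₀ hz) ?_ ?_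
    (hint.const_mul C) ?_).2.differentiableAt
  · filter_upwards [hs] with z hz'
    exact mb_meas F hF z hz'.1
  · refine (mbK_cont.aestronglyMeasurable.mul hF.aestronglyMeasurable).mul ?_
    apply Continuous.aestronglyMeasurable
    exact Continuous.mul (by fun_prop) (Continuous.const_cpow (by fun_prop) (Or.inl hz0))
  · refine Eventually.of_forall fun τ z hz' => ?_
    obtain ⟨hz1, hz2, hz3⟩ := hz'
    have h := mb_cpow_norm z (Complex.slitPlane_ne_zero hz1) (3 / 2) τ
    rw [show (-(((3 / 2 : ℝ) : ℂ) + τ * Complex.I)) = -(1 / 2 + τ * Complex.I) - 1 by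
      push_cast; ring] at h
    have h2 : ‖z‖ ^ (-(3 / 2 : ℝ)) ≤ (‖z₀‖ / 2) ^ (-(3 / 2 : ℝ)) :=
      Real.rpow_le_rpow_of_nonpos (by positivity) hz3.le (by norm_num)
    have h3 : ‖-(1 / 2 + τ * Complex.I)‖ ≤ 1 / 2 + |τ| := by
      rw [norm_neg]
      refine (norm_add_le _ _).trans ?_
      simp
    have h4 : 1 / 2 + |τ| ≤ (1 / 2 + 1 / δ) * Real.exp (δ * |τ|) := by
      have a1 : δ * |τ| + 1 ≤ Real.exp (δ * |τ|) := Real.add_one_le_exp _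
      have a2 : 0 ≤ δ * |τ| := by positivity
      have a3 : |τ| = 1 / δ * (δ * |τ|) := by field_simp
      have a4 : 1 / δ * (δ * |τ|) ≤ 1 / δ * Real.exp (δ * |τ|) := by
        gcongr
        linarith
      linarith
    simp only [F', norm_mul]
    calc _ ≤ √(2 * π) * ‖F τ‖ * (((1 / 2 + 1 / δ) * Real.exp (δ * |τ|)) *
          ((‖z₀‖ / 2) ^ (-(3 / 2 : ℝ)) * Real.exp ((π - δ) * |τ|))) := by
          gcongr
          · exact mbK_bound τ
          · exact h3.trans h4
          · refine h.trans ?_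
            gcongr
      _ = C * ((Real.exp (δ * |τ|) * Real.exp ((π - δ) * |τ|)) * ‖F τ‖) := by
          simp only [C]; ring
      _ = _ := by
          rw [← Real.exp_add]; congr 4; ring
  · refine Eventually.of_forall fun τ z hz' => ?_
    have := (hasDerivAt_id z).cpow_const (c := -(1 / 2 + τ * Complex.I)) hz'.1
    simpa [F'] using this.const_mul (mbK τ * F τ)

/-- Analyticity of the Mellin–Barnes representation: if `∫ e^{π|τ|}|F(τ)| dτ < ∞`, then
`Φ(z) = (2π)⁻¹ ∫ Γ(1/2+iτ)[sin(π(1/2+iτ)/2) + cos(π(1/2+iτ)/2)] F(τ) z^{-(1/2+iτ)} dτ`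
is well defined (the integral converges absolutely) and holomorphic on the slit plane
`ℂ ∖ (-∞, 0]`. -/
theorem mellin_barnes_analytic (F : ℝ → ℂ) (hF : Measurable F)
    (hint : Integrable (fun τ : ℝ => Real.exp (π * |τ|) * ‖F τ‖)) :
    (∀ z ∈ Complex.slitPlane, Integrable (fun τ : ℝ =>
        Complex.Gamma (1 / 2 + τ * Complex.I) *
          (Complex.sin (π * (1 / 2 + τ * Complex.I) / 2) +
            Complex.cos (π * (1 / 2 + τ * Complex.I) / 2)) *
          F τ * z ^ (-(1 / 2 + τ * Complex.I)))) ∧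
      DifferentiableOn ℂ
        (fun z : ℂ => (((2 * π)⁻¹ : ℝ) : ℂ) *
          ∫ τ : ℝ,
            Complex.Gamma (1 / 2 + τ * Complex.I) *
              (Complex.sin (π * (1 / 2 + τ * Complex.I) / 2) +
                Complex.cos (π * (1 / 2 + τ * Complex.I) / 2)) *
              F τ * z ^ (-(1 / 2 + τ * Complex.I)))
        Complex.slitPlane := by
  exact ⟨fun z hz => mb_int F hF hint z hz, fun z hz =>
    ((mb_diff F hF hint z hz).const_mul _).differentiableWithinAt⟩
end
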